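/- arXiv:math/0311117 — 3 statements merged into one kernel-verified Lean document; each statement's English description precedes it below -/
import Mathlib

section
/- Let K be an infinite field and let A and B be m×m matrices with entries in K. If there exists an invertible m×m matrix Q over an algebraic closure of K with Q·A·Q⁻¹ = B, then there exists an invertible m×m matrix P with entries in K such that P·A·P⁻¹ = B. -/
namespace Matrix

variable {K L l m n : Type*} [CommRing K] [CommRing L] [Algebra K L] [Fintype m]

theorem map_linearMap_mul_map_algebraMap (f : L →ₗ[K] K) (Q : Matrix l m L) (A : Matrix m n K) :
    (Q * A.map (algebraMap K L)).map f = Q.map f * A := by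
  ext i j
  simp only [map_apply, mul_apply, map_sum]
  refine Finset.sum_congr rfl fun k _ => ?_
  rw [← Algebra.commutes, ← Algebra.smul_def, map_smul, smul_eq_mul, mul_comm]

theorem map_linearMap_map_algebraMap_mul (f : L →ₗ[K] K) (B : Matrix l m K) (Q : Matrix m n L) :
    (B.map (algebraMap K L) * Q).map f = B * Q.map f := by
  ext i j
  simp [mul_apply, map_sum, ← Algebra.smul_def]

/-- Over an infinite domain `K`, an intertwiner of `A` and `B` with nonzero determinant over a
free `K`-algebra yields one over `K`. -/
theorem exists_det_ne_zero_and_mul_eq_mul [IsDomain K] [Infinite K] [Module.Free K L]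
    [DecidableEq m] {A B : Matrix m m K} {Q : Matrix m m L} (hQ : Q.det ≠ 0)
    (h : Q * A.map (algebraMap K L) = B.map (algebraMap K L) * Q) :
    ∃ P : Matrix m m K, P.det ≠ 0 ∧ P * A = B * P := by
  classical
  let b := Module.Free.chooseBasis K L
  let C i : Matrix m m K := Q.map (b.coord i)
  have hC i : C i * A = B * C i := by
    rw [← map_linearMap_mul_map_algebraMap, h, map_linearMap_map_algebraMap_mul]
  let s := Finset.univ.biUnion fun jk : m × m => (b.repr (Q jk.1 jk.2)).support
  let M : Matrix m m (MvPolynomial (Module.Free.ChooseBasisIndex K L) K) :=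
    ∑ i ∈ s, (MvPolynomial.X i : MvPolynomial (Module.Free.ChooseBasisIndex K L) K) •
      (C i).map MvPolynomial.C
  have hM : (MvPolynomial.aeval b).mapMatrix M = Q := by
    ext j k
    rw [← b.linearCombination_repr (Q j k), Finsupp.linearCombination_apply,
      Finsupp.sum_of_support_subset (s := s) _ _ _ (by simp)]
    · simp only [M, C, AlgHom.mapMatrix_apply, map_apply, sum_apply, smul_apply, smul_eq_mul]
      simp [Algebra.smul_def, mul_comm]
    · intro i hi
      exact Finset.mem_biUnion.2 ⟨(j, k), Finset.mem_univ _, hi⟩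
  have hdet : M.det ≠ 0 := fun h0 => hQ <| by rw [← hM, ← AlgHom.map_det, h0, map_zero]
  obtain ⟨x, hx⟩ : ∃ x, MvPolynomial.eval x M.det ≠ 0 := by
    by_contra! h0
    exact hdet (MvPolynomial.funext fun x => by rw [h0, map_zero])
  have hP : (MvPolynomial.eval x).mapMatrix M = ∑ i ∈ s, x i • C i := by
    ext j k
    simp [M, sum_apply]
  refine ⟨∑ i ∈ s, x i • C i, ?_, ?_⟩
  · rwa [← hP, ← RingHom.map_det]
  · simp [Finset.sum_mul, Finset.mul_sum, hC]

end Matrix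

/-- **Conjugacy over an infinite field descends from the algebraic closure.**
If two `m × m` matrices over an infinite field `K` are conjugate by an invertible
matrix over an algebraic closure of `K`, then they are conjugate by an invertible
matrix over `K` itself. -/
theorem conjugate_over_base_of_conjugate_over_algebraicClosure
    (K : Type*) [Field K] [Infinite K] (m : ℕ)
    (A B : Matrix (Fin m) (Fin m) K)
    (h : ∃ Q : GL (Fin m) (AlgebraicClosure K),
      (Q : Matrix (Fin m) (Fin m) (AlgebraicClosure K)) *
          A.map (algebraMap K (AlgebraicClosure K)) *
          ((Q⁻¹ : GL (Fin m) (AlgebraicClosure K)) :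
            Matrix (Fin m) (Fin m) (AlgebraicClosure K)) =
        B.map (algebraMap K (AlgebraicClosure K))) :
    ∃ P : GL (Fin m) K,
      (P : Matrix (Fin m) (Fin m) K) * A *
          ((P⁻¹ : GL (Fin m) K) : Matrix (Fin m) (Fin m) K) = B := by
  obtain ⟨Q, hQ⟩ := h
  have hcomm : (Q : Matrix (Fin m) (Fin m) (AlgebraicClosure K)) *
      A.map (algebraMap K (AlgebraicClosure K)) =
        B.map (algebraMap K (AlgebraicClosure K)) * Q := by
    rw [← hQ, mul_assoc _ _ (Q : Matrix (Fin m) (Fin m) (AlgebraicClosure K)), Units.inv_mul,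
      mul_one]
  obtain ⟨P, hP, hPA⟩ := Matrix.exists_det_ne_zero_and_mul_eq_mul
    ((Matrix.isUnit_iff_isUnit_det _).1 Q.isUnit).ne_zero hcomm
  refine ⟨Matrix.GeneralLinearGroup.mkOfDetNeZero P hP, ?_⟩
  rw [Units.mul_inv_eq_iff_eq_mul]
  exact hPA
end

section
/- Let R be a Dedekind domain whose field of fractions K has characteristic 0, let P be a finitely generated projective R-module, and let A be an R-module endomorphism of P. Then there exists a direct sum decomposition P = P₁ ⊕ ⋯ ⊕ P_d into R-submodules such that for every j the submodule P₁ ⊕ ⋯ ⊕ Pⱼ is mapped into itself by A, and the K-linear endomorphism induced by A on ((P₁ ⊕ ⋯ ⊕ Pⱼ)/(P₁ ⊕ ⋯ ⊕ P_{j−1})) ⊗_R K has characteristic polynomial irreducible over K. -/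
open Polynomial in
/-- An endomorphism of a nonzero finite-dimensional vector space without proper nonzero invariant
subspaces has irreducible characteristic polynomial. -/
theorem LinearMap.irreducible_charpoly_of_forall_invariant_eq_bot_or_eq_top
    {K V : Type*} [Field K] [AddCommGroup V] [Module K V] [FiniteDimensional K V] [Nontrivial V]
    (f : V →ₗ[K] V)
    (hf : ∀ W : Submodule K V, W ≤ W.comap f → W = ⊥ ∨ W = ⊤) : Irreducible f.charpoly := by
  have hint : IsIntegral K f := Algebra.IsIntegral.isIntegral f
  have hmonic := minpoly.monic hint
  obtain ⟨v, hv⟩ := exists_ne (0 : V)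
  have hker : ∀ p : K[X], LinearMap.ker (aeval f p) = ⊥ ∨ aeval f p = 0 := fun p ↦ by
    rw [← LinearMap.ker_eq_top]
    refine hf _ fun x hx ↦ ?_
    have hcomm : Commute (aeval f p) f := by
      simpa using (Commute.all p X).map (aeval f)
    have : aeval f p (f x) = f (aeval f p x) := LinearMap.congr_fun hcomm.eq x
    simp_all
  have hirr : Irreducible (minpoly K f) := by
    refine (irreducible_of_monic hmonic <| minpoly.ne_one K f).2 fun p q hp hq he ↦ ?_
    rw [← hp.isUnit_iff, ← hq.isUnit_iff]
    by_contra! h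
    have hp0 := minpoly.aeval_ne_zero_of_dvdNotUnit_minpoly hint hp
      ⟨hp.ne_zero, q, h.2, he.symm⟩
    have hq0 := minpoly.aeval_ne_zero_of_dvdNotUnit_minpoly hint hq
      ⟨hq.ne_zero, p, h.1, by rw [mul_comm, he]⟩
    have hinj := LinearMap.ker_eq_bot.1 ((hker p).resolve_right hp0)
    refine hq0 (LinearMap.ext fun x ↦ hinj ?_)
    have hzero : aeval f p * aeval f q = 0 := by rw [← map_mul, he, minpoly.aeval]
    simpa using LinearMap.congr_fun hzero x
  let φ : K[X] →ₗ[K] V := (LinearMap.applyₗ v) ∘ₗ (aeval f).toLinearMap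
  have hφ : LinearMap.range φ = ⊤ := by
    refine (hf _ ?_).resolve_left fun h ↦ hv ?_
    · rintro _ ⟨p, rfl⟩
      exact ⟨X * p, by simp [φ]⟩
    · have : φ 1 ∈ LinearMap.range φ := ⟨1, rfl⟩
      simpa [h, φ] using this
  have hle : Module.finrank K V ≤ (minpoly K f).natDegree := by
    have hsurj : Function.Surjective (φ ∘ₗ (degreeLT K (minpoly K f).natDegree).subtype) := by
      intro w
      obtain ⟨p, rfl⟩ := LinearMap.range_eq_top.1 hφ w
      refine ⟨⟨p %ₘ minpoly K f, ?_⟩, ?_⟩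
      · rw [mem_degreeLT, ← degree_eq_natDegree hmonic.ne_zero]
        exact degree_modByMonic_lt _ hmonic
      · have := minpoly.aeval K f
        simp [φ, aeval_modByMonic_eq_self_of_root this]
    have e := degreeLTEquiv K (minpoly K f).natDegree
    have := Module.Finite.equiv e.symm
    simpa [e.finrank_eq] using LinearMap.finrank_le_finrank_of_surjective hsurj
  rw [← f.charpoly_natDegree] at hle
  rwa [Polynomial.eq_of_monic_of_dvd_of_natDegree_le hmonic f.charpoly_monic
    f.minpoly_dvd_charpoly hle]

namespace Submodule

variable {R : Type*} [CommRing R] {M : Type*} [AddCommGroup M] [Module R M]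

/-- A submodule `N` is saturated if it contains every element having a nonzero multiple in `N`. -/
def IsSaturated (N : Submodule R M) : Prop :=
  ∀ ⦃r : R⦄ ⦃x : M⦄, r ≠ 0 → r • x ∈ N → x ∈ N

theorem IsSaturated.isTorsionFree_quotient [IsDomain R] {N : Submodule R M} (hN : N.IsSaturated) :
    Module.IsTorsionFree R (M ⧸ N) := by
  refine .of_smul_eq_zero fun r x h ↦ ?_
  obtain ⟨x, rfl⟩ := N.mkQ_surjective x
  by_contra! hrx
  refine hrx.2 ((Quotient.mk_eq_zero N).2 (hN hrx.1 ?_))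
  rwa [← Quotient.mk_eq_zero]

theorem IsSaturated.comap {M' : Type*} [AddCommGroup M'] [Module R M'] {N : Submodule R M'}
    (hN : N.IsSaturated) (f : M →ₗ[R] M') : (N.comap f).IsSaturated :=
  fun _ _ hr hx ↦ hN hr (by simpa using hx)

theorem IsSaturated.map_subtype {N : Submodule R M} (hN : N.IsSaturated) {L : Submodule R N}
    (hL : L.IsSaturated) : (L.map N.subtype).IsSaturated := by
  rintro r x hr ⟨y, hy, hyx⟩
  refine ⟨⟨x, hN hr (hyx ▸ y.2)⟩, hL hr ?_, rfl⟩
  rwa [show r • (⟨x, _⟩ : N) = y from Subtype.ext hyx.symm]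

theorem exists_isCompl_of_projective_quotient (N : Submodule R M) [Module.Projective R (M ⧸ N)] :
    ∃ Q : Submodule R M, IsCompl N Q := by
  obtain ⟨s, hs⟩ := N.mkQ.exists_rightInverse_of_surjective N.range_mkQ
  have hs' : ∀ y, N.mkQ (s y) = y := LinearMap.congr_fun hs
  refine ⟨LinearMap.range s, disjoint_def.2 ?_, codisjoint_iff_exists_add_eq.2 fun x ↦ ?_⟩
  · rintro _ hx ⟨y, rfl⟩
    have : y = 0 := by rw [← hs' y]; simpa using hx
    simp [this]
  · refine ⟨x - s (N.mkQ x), s (N.mkQ x), ?_, ⟨_, rfl⟩, by simp⟩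
    refine (Submodule.Quotient.mk_eq_zero N).1 ?_
    rw [← mkQ_apply, map_sub, hs', sub_self]

theorem IsSaturated.exists_isCompl [IsDedekindDomain R] [Module.Finite R M]
    {N : Submodule R M} (hN : N.IsSaturated) : ∃ Q : Submodule R M, IsCompl N Q := by
  have := hN.isTorsionFree_quotient
  have : Module.FinitePresentation R (M ⧸ N) := Module.finitePresentation_of_finite R _
  have : Module.Projective R (M ⧸ N) := Module.Flat.projective_of_finitePresentation
  exact N.exists_isCompl_of_projective_quotient

theorem IsSaturated.finrank_lt_of_lt [IsDomain R] [IsNoetherianRing R] [Module.Finite R M]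
    {N N' : Submodule R M} (hN' : N'.IsSaturated) (h : N' < N) :
    Module.finrank R N' < Module.finrank R N := by
  have hsat : (N'.comap N.subtype).IsSaturated := hN'.comap _
  have := hsat.isTorsionFree_quotient
  have : Nontrivial (N ⧸ N'.comap N.subtype) :=
    Quotient.nontrivial_iff.2 fun htop ↦ h.not_ge (comap_subtype_eq_top.1 htop)
  have hpos : 0 < Module.finrank R (N ⧸ N'.comap N.subtype) := Module.finrank_pos
  have hadd := (N'.comap N.subtype).finrank_quotient_add_finrank
  rw [(comapSubtypeEquivOfLe h.le).finrank_eq] at hadd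
  lia

end Submodule

/-- If a finitely generated torsion-free module has no proper nonzero saturated submodule that is
invariant under `B`, then the characteristic polynomial of `B` is irreducible. -/
theorem LinearMap.irreducible_charpoly_baseChange_of_forall_isSaturated
    {R : Type*} [CommRing R] [IsDomain R] (K : Type*) [Field K] [Algebra R K] [IsFractionRing R K]
    {V : Type*} [AddCommGroup V] [Module R V] [Module.Finite R V] [Module.IsTorsionFree R V]
    [Nontrivial V] (B : V →ₗ[R] V)
    (hB : ∀ N : Submodule R V, N.IsSaturated → N ≤ N.comap B → N = ⊥ ∨ N = ⊤) :
    Irreducible (B.baseChange K).charpoly := by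
  let ι : V →ₗ[R] TensorProduct R K V := TensorProduct.mk R K V 1
  have hloc : IsLocalizedModule (nonZeroDivisors R) ι := inferInstance
  have hfrac : ∀ w, ∃ v : V, ∃ r : R, r ≠ 0 ∧ algebraMap R K r • w = ι v := fun w ↦ by
    obtain ⟨⟨v, r⟩, h⟩ := IsLocalizedModule.surj (nonZeroDivisors R) ι w
    exact ⟨v, r, nonZeroDivisors.ne_zero r.2, by rw [algebraMap_smul]; exact h⟩
  have : Nontrivial (TensorProduct R K V) := by
    refine Module.nontrivial_of_finrank_pos (R := K) ?_
    rw [(TensorProduct.isBaseChange R V K).finrank_eq]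
    exact Module.finrank_pos
  refine LinearMap.irreducible_charpoly_of_forall_invariant_eq_bot_or_eq_top _ fun W hW ↦ ?_
  have hmem : ∀ {r : R} {w}, r ≠ 0 → (algebraMap R K r • w ∈ W ↔ w ∈ W) := fun hr ↦
    W.smul_mem_iff ((map_ne_zero_iff _ (IsFractionRing.injective R K)).2 hr)
  have hsat : ((W.restrictScalars R).comap ι).IsSaturated := fun r x hr hx ↦
    (hmem hr).1 (by simpa using hx)
  refine (hB _ hsat fun x hx ↦ ?_).imp (fun h ↦ ?_) fun h ↦ ?_
  · simpa [ι] using hW hx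
  · refine (Submodule.eq_bot_iff W).2 fun w hw ↦ ?_
    obtain ⟨v, r, hr, hv⟩ := hfrac w
    have hv0 : v ∈ (W.restrictScalars R).comap ι := by
      change ι v ∈ W
      exact hv ▸ (hmem hr).2 hw
    rw [h, Submodule.mem_bot] at hv0
    rw [hv0, map_zero, smul_eq_zero] at hv
    exact hv.resolve_left ((map_ne_zero_iff _ (IsFractionRing.injective R K)).2 hr)
  · refine (Submodule.eq_top_iff').2 fun w ↦ ?_
    obtain ⟨v, r, hr, hv⟩ := hfrac w
    have hv' : v ∈ (W.restrictScalars R).comap ι := h ▸ Submodule.mem_top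
    exact (hmem hr).1 (hv ▸ hv')

namespace Fin

theorem biSup_Iic_snoc_castSucc {α : Type*} [CompleteLattice α] {d : ℕ} (f : Fin d → α) (a : α)
    (j : Fin d) : ⨆ i ∈ Finset.Iic j.castSucc, snoc (α := fun _ ↦ α) f a i =
      ⨆ i ∈ Finset.Iic j, f i := by
  refine le_antisymm (iSup₂_le fun i hi ↦ ?_) (iSup₂_le fun i hi ↦ ?_)
  · induction i using Fin.lastCases with
    | last => simp at hi
    | cast i =>
      rw [snoc_castSucc]
      exact le_iSup₂ (f := fun i _ ↦ f i) i (by simpa using hi)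
  · exact le_iSup₂_of_le i.castSucc (by simpa using hi) (by simp)

theorem biSup_Iio_snoc_castSucc {α : Type*} [CompleteLattice α] {d : ℕ} (f : Fin d → α) (a : α)
    (j : Fin d) : ⨆ i ∈ Finset.Iio j.castSucc, snoc (α := fun _ ↦ α) f a i =
      ⨆ i ∈ Finset.Iio j, f i := by
  refine le_antisymm (iSup₂_le fun i hi ↦ ?_) (iSup₂_le fun i hi ↦ ?_)
  · induction i using Fin.lastCases with
    | last => exact absurd (Finset.mem_Iio.1 hi) (Fin.le_last _).not_gt
    | cast i =>
      rw [snoc_castSucc]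
      exact le_iSup₂ (f := fun i _ ↦ f i) i (by simpa using hi)
  · exact le_iSup₂_of_le i.castSucc (by simpa using hi) (by simp)

theorem biSup_Iio_last_snoc {α : Type*} [CompleteLattice α] {d : ℕ} (f : Fin d → α) (a : α) :
    ⨆ i ∈ Finset.Iio (last d), snoc (α := fun _ ↦ α) f a i = ⨆ i, f i := by
  refine le_antisymm (iSup₂_le fun i hi ↦ ?_) (iSup_le fun i ↦ ?_)
  · induction i using Fin.lastCases with
    | last => simp at hi
    | cast i =>
      rw [snoc_castSucc]
      exact le_iSup f i
  · exact le_iSup₂_of_le i.castSucc (by simp) (by simp)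

theorem iSup_snoc {α : Type*} [CompleteLattice α] {d : ℕ} (f : Fin d → α) (a : α) :
    ⨆ i, snoc (α := fun _ ↦ α) f a i = (⨆ i, f i) ⊔ a := by
  refine le_antisymm (iSup_le fun i ↦ ?_) (sup_le (iSup_le fun i ↦ ?_) ?_)
  · induction i using Fin.lastCases with
    | last => simp
    | cast i => simpa using le_sup_of_le_left (le_iSup f i)
  · exact le_iSup_of_le i.castSucc (by simp)
  · exact le_iSup_of_le (last d) (by simp)

theorem biSup_Iic_last {α : Type*} [CompleteLattice α] {d : ℕ} (f : Fin (d + 1) → α) :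
    ⨆ i ∈ Finset.Iic (last d), f i = ⨆ i, f i := by
  simp [Fin.le_last]

theorem iSupIndep_snoc {α : Type*} [CompleteLattice α] [IsModularLattice α] {d : ℕ}
    {f : Fin d → α} {a : α} (hf : iSupIndep f) (ha : Disjoint (⨆ i, f i) a) :
    iSupIndep (snoc (α := fun _ ↦ α) f a) := by
  have huniv : (Finset.univ : Finset (Fin (d + 1))) =
      insert (last d) (Finset.univ.map Fin.castSuccEmb) := by
    rw [Fin.univ_castSuccEmb, Finset.cons_eq_insert]
  rw [iSupIndep_iff_supIndep_univ, huniv]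
  refine Finset.SupIndep.insert (Finset.supIndep_map.2 ?_) ?_
  · convert iSupIndep_iff_supIndep_univ.1 hf
    ext i
    simp
  · rw [Finset.sup_map, Finset.sup_eq_iSup]
    simpa using ha.symm

end Fin

namespace LinearMap

variable {R : Type*} [CommRing R] (K : Type*) [Field K] [Algebra R K]
  {P : Type*} [AddCommGroup P] [Module R P] [Module.Finite R P]

/-- `A` induces an endomorphism of `(N / (N' ∩ N)) ⊗ K` whose characteristic polynomial is
irreducible. -/
def HasIrreducibleFactor [IsNoetherianRing R] (A : P →ₗ[R] P) (N' N : Submodule R P) : Prop :=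
  ∃ (hN : ∀ x ∈ N, A x ∈ N)
    (hN' : N'.comap N.subtype ≤ (N'.comap N.subtype).comap (A.restrict hN)),
    Irreducible ((LinearMap.baseChange K
      (Submodule.mapQ (N'.comap N.subtype) (N'.comap N.subtype) (A.restrict hN) hN')).charpoly)

variable [IsFractionRing R K]

/-- If `N'` is maximal among the saturated invariant submodules strictly contained in `N`, then `A`
has irreducible characteristic polynomial on `N / N'`. -/
theorem hasIrreducibleFactor_of_maximal [IsDomain R] [IsNoetherianRing R] {A : P →ₗ[R] P}
    {N' N : Submodule R P} (hN : N.IsSaturated) (hAN : N ≤ N.comap A)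
    (hN' : Maximal (fun L : Submodule R P ↦ L.IsSaturated ∧ L ≤ L.comap A ∧ L < N) N') :
    A.HasIrreducibleFactor K N' N := by
  obtain ⟨⟨hsat, hAN', hlt⟩, hmax⟩ := hN'
  have hsat' : (N'.comap N.subtype).IsSaturated := hsat.comap _
  have := hsat'.isTorsionFree_quotient
  have : Nontrivial (N ⧸ N'.comap N.subtype) :=
    Submodule.Quotient.nontrivial_iff.2 fun h ↦ hlt.not_ge (Submodule.comap_subtype_eq_top.1 h)
  refine ⟨fun x hx ↦ hAN hx, fun x hx ↦ hAN' hx, ?_⟩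
  refine irreducible_charpoly_baseChange_of_forall_isSaturated K _ fun L hL hAL ↦ ?_
  have hinj : Function.Injective (Submodule.comap (N'.comap N.subtype).mkQ) :=
    Submodule.comap_injective_of_surjective (Submodule.mkQ_surjective _)
  let L' : Submodule R P := (L.comap (N'.comap N.subtype).mkQ).map N.subtype
  have hcomap : L'.comap N.subtype = L.comap (N'.comap N.subtype).mkQ :=
    Submodule.comap_map_eq_of_injective N.injective_subtype _
  have hAL' : L' ≤ L'.comap A := by
    rintro _ ⟨x, hx, rfl⟩
    exact ⟨A.restrict (q := N) (fun x hx ↦ hAN hx) x, hAL hx, rfl⟩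
  have hNL' : N' ≤ L' := fun x hx ↦
    ⟨⟨x, hlt.le hx⟩, by
      have : (N'.comap N.subtype).mkQ ⟨x, hlt.le hx⟩ = 0 := by simpa using hx
      change (N'.comap N.subtype).mkQ ⟨x, hlt.le hx⟩ ∈ L
      rw [this]
      exact L.zero_mem, rfl⟩
  rcases (Submodule.map_subtype_le N _ : L' ≤ N).lt_or_eq with h | h
  · left
    have hLN : L' = N' := le_antisymm (hmax ⟨hN.map_subtype (hL.comap _), hAL', h⟩ hNL') hNL'
    apply hinj
    rw [← hcomap, hLN]
    exact (Submodule.ker_mkQ _).symm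
  · right
    apply hinj
    rw [← hcomap, show L' = N from h, Submodule.comap_top, Submodule.comap_subtype_self]

/-- Every saturated `A`-invariant submodule is the internal direct sum of a finite sequence of
submodules with invariant partial sums and irreducible characteristic polynomials on the
successive quotients. -/
theorem exists_iSupIndep_hasIrreducibleFactor [IsDedekindDomain R] [Module.IsTorsionFree R P]
    (A : P →ₗ[R] P) (N : Submodule R P) (hN : N.IsSaturated) (hAN : N ≤ N.comap A) :
    ∃ (d : ℕ) (Pk : Fin d → Submodule R P), iSupIndep Pk ∧ ⨆ i, Pk i = N ∧
      ∀ j, A.HasIrreducibleFactor K (⨆ i ∈ Finset.Iio j, Pk i) (⨆ i ∈ Finset.Iic j, Pk i) := by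
  induction h : Module.finrank R N using Nat.strong_induction_on generalizing N with
  | _ n ih =>
  obtain rfl | hne := eq_or_ne N ⊥
  · exact ⟨0, Fin.elim0, iSupIndep_subsingleton _, by simp, fun j ↦ j.elim0⟩
  have hbot : (⊥ : Submodule R P).IsSaturated := fun r x hr hx ↦
    (smul_eq_zero.1 hx).resolve_left hr
  obtain ⟨N', -, hN'⟩ := exists_maximal_ge_of_wellFoundedGT
    (fun L : Submodule R P ↦ L.IsSaturated ∧ L ≤ L.comap A ∧ L < N) ⊥
    ⟨hbot, bot_le, bot_lt_iff_ne_bot.2 hne⟩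
  obtain ⟨hsat, hAN', hlt⟩ := hN'.prop
  obtain ⟨d, Pk, hind, rfl, hPk⟩ := ih _ (h ▸ hsat.finrank_lt_of_lt hlt) N' hsat hAN' rfl
  obtain ⟨Q, hQ⟩ := hsat.exists_isCompl
  have hsup : (⨆ i, Pk i) ⊔ Q ⊓ N = N := by
    rw [← sup_inf_assoc_of_le Q hlt.le, hQ.sup_eq_top, top_inf_eq]
  refine ⟨d + 1, Fin.snoc Pk (Q ⊓ N),
    Fin.iSupIndep_snoc hind (hQ.disjoint.mono_right inf_le_left), ?_, fun j ↦ ?_⟩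
  · rw [Fin.iSup_snoc, hsup]
  · induction j using Fin.lastCases with
    | last =>
      rw [Fin.biSup_Iio_last_snoc, Fin.biSup_Iic_last, Fin.iSup_snoc, hsup]
      exact hasIrreducibleFactor_of_maximal K hN hAN hN'
    | cast j =>
      rw [Fin.biSup_Iio_snoc_castSucc, Fin.biSup_Iic_snoc_castSucc]
      exact hPk j

end LinearMap


/-- **Block triangularization of endomorphisms of projective modules over Dedekind domains.**
Let `R` be a Dedekind domain whose fraction field `K` has characteristic zero, `P` a
finitely generated projective `R`-module and `A` an `R`-endomorphism of `P`.  Then `P`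
decomposes as an internal direct sum of submodules `P₁, …, P_d` such that each partial sum
`N_j = P₁ ⊕ ⋯ ⊕ P_j` is `A`-invariant, and the endomorphism induced by `A` on
`(N_j / N_{j-1}) ⊗ K` has characteristic polynomial irreducible over `K`. -/
theorem exists_block_triangular_decomposition_of_projective
    (R : Type*) [CommRing R] [IsDomain R] [IsDedekindDomain R]
    (K : Type*) [Field K] [CharZero K] [Algebra R K] [IsFractionRing R K]
    (P : Type*) [AddCommGroup P] [Module R P] [Module.Finite R P] [Module.Projective R P]
    (A : P →ₗ[R] P) :
    ∃ (d : ℕ) (Pk : Fin d → Submodule R P),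
      DirectSum.IsInternal Pk ∧
      ∀ j : Fin d,
        ∃ (hN : ∀ x ∈ ⨆ i ∈ Finset.Iic j, Pk i, A x ∈ ⨆ i ∈ Finset.Iic j, Pk i)
          (hN' : ((⨆ i ∈ Finset.Iio j, Pk i).comap (⨆ i ∈ Finset.Iic j, Pk i).subtype) ≤
            (((⨆ i ∈ Finset.Iio j, Pk i).comap
                (⨆ i ∈ Finset.Iic j, Pk i).subtype).comap (A.restrict hN))),
          Irreducible
            ((LinearMap.baseChange K
                (Submodule.mapQ
                  ((⨆ i ∈ Finset.Iio j, Pk i).comap (⨆ i ∈ Finset.Iic j, Pk i).subtype)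
                  ((⨆ i ∈ Finset.Iio j, Pk i).comap (⨆ i ∈ Finset.Iic j, Pk i).subtype)
                  (A.restrict hN) hN')).charpoly) := by
  obtain ⟨d, Pk, hind, hsup, hPk⟩ := A.exists_iSupIndep_hasIrreducibleFactor K ⊤
    (fun _ _ _ _ ↦ Submodule.mem_top) le_top
  exact ⟨d, Pk, DirectSum.isInternal_submodule_of_iSupIndep_of_iSup_eq_top hind hsup, hPk⟩
end

section
/- Let K be a number field whose ring of integers O_K is a principal ideal domain, and let f ∈ O_K[t] be a monic polynomial of degree m that is irreducible over K. Then there is a bijection between the set of GL_m(O_K)-conjugacy classes of matrices A ∈ M_m(O_K) with characteristic polynomial f, and the set of isomorphism classes (as modules over O_K[t]/(f)) of nonzero ideals of the ring O_K[t]/(f). -/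
open scoped NumberField Polynomial

/-- A relation between two types that is total on both sides and matches `r` with `s` induces
a bijection between the quotients by `r` and `s`. -/
theorem nonempty_quot_equiv_of_rel {α β : Type*} {r : α → α → Prop} {s : β → β → Prop}
    (T : α → β → Prop) (left_total : ∀ a, ∃ b, T a b) (right_total : ∀ b, ∃ a, T a b)
    (r_refl : ∀ a, r a a) (s_refl : ∀ b, s b b)
    (rel_iff : ∀ a b a' b', T a b → T a' b' → (r a a' ↔ s b b')) :
    Nonempty (Quot r ≃ Quot s) := by
  choose g hg using left_total
  choose h hh using right_total
  exact ⟨{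
    toFun := Quot.map g fun a a' haa' => (rel_iff _ _ _ _ (hg a) (hg a')).1 haa'
    invFun := Quot.map h fun b b' hbb' => (rel_iff _ _ _ _ (hh b) (hh b')).2 hbb'
    left_inv := by
      rintro ⟨a⟩
      exact Quot.sound ((rel_iff _ _ _ _ (hh (g a)) (hg a)).2 (s_refl _))
    right_inv := by
      rintro ⟨b⟩
      exact Quot.sound ((rel_iff _ _ _ _ (hg (h b)) (hh b)).1 (r_refl _)) }⟩

namespace PowerBasis

variable {R S : Type*} [CommRing R] [CommRing S] [Algebra R S]

/-- An `R`-linear map commuting with the generator of a power basis of `S` is `S`-linear. -/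
theorem map_smul_of_map_gen_smul (pb : PowerBasis R S) {M N : Type*}
    [AddCommGroup M] [Module R M] [Module S M] [IsScalarTower R S M]
    [AddCommGroup N] [Module R N] [Module S N] [IsScalarTower R S N]
    (φ : M →ₗ[R] N) (hφ : ∀ x, φ (pb.gen • x) = pb.gen • φ x) (s : S) (x : M) :
    φ (s • x) = s • φ x := by
  have hs : s ∈ Algebra.adjoin R {pb.gen} := by rw [pb.adjoin_gen_eq_top]; trivial
  induction hs using Algebra.adjoin_induction generalizing x with
  | mem y hy => rw [Set.mem_singleton_iff.1 hy, hφ]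
  | algebraMap r => simp only [algebraMap_smul, map_smul]
  | add y z _ _ hy hz => simp only [add_smul, map_add, hy, hz]
  | mul y z _ _ hy hz => simp only [mul_smul, hy, hz]

/-- The matrix `A` describes multiplication by the generator of the power basis on the
ideal `I`, in some `R`-basis of `I`. -/
def IsMulGenMatrix (pb : PowerBasis R S) {m : ℕ} (A : Matrix (Fin m) (Fin m) R)
    (I : Ideal S) : Prop :=
  ∃ e : (Fin m → R) ≃ₗ[R] I, ∀ v, e (A.mulVec v) = pb.gen • e v

/-- Matrices of multiplication by the generator on two ideals are conjugate if and only if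
the ideals are isomorphic. -/
theorem IsMulGenMatrix.conj_iff {pb : PowerBasis R S} {m : ℕ}
    {A B : Matrix (Fin m) (Fin m) R} {I J : Ideal S}
    (hA : pb.IsMulGenMatrix A I) (hB : pb.IsMulGenMatrix B J) :
    (∃ P : GL (Fin m) R, (P : Matrix (Fin m) (Fin m) R) * A *
      ((P⁻¹ : GL (Fin m) R) : Matrix (Fin m) (Fin m) R) = B) ↔ Nonempty (I ≃ₗ[S] J) := by
  obtain ⟨e, he⟩ := hA
  obtain ⟨e', he'⟩ := hB
  constructor
  · rintro ⟨P, hP⟩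
    have hPA : (P : Matrix (Fin m) (Fin m) R) * A = B * P := by
      rw [← hP, mul_assoc, Units.inv_mul, mul_one]
    let p : (Fin m → R) ≃ₗ[R] (Fin m → R) :=
      LinearEquiv.ofLinearMap (Matrix.mulVecLin P)
        (Matrix.mulVecLin ((P⁻¹ : GL (Fin m) R) : Matrix (Fin m) (Fin m) R))
        (by rw [← Matrix.mulVecLin_mul, Units.mul_inv, Matrix.mulVecLin_one])
        (by rw [← Matrix.mulVecLin_mul, Units.inv_mul, Matrix.mulVecLin_one])
    let φ : I ≃ₗ[R] J := e.symm ≪≫ₗ p ≪≫ₗ e'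
    have hφ : ∀ x, φ (pb.gen • x) = pb.gen • φ x := by
      intro x
      obtain ⟨v, rfl⟩ := e.surjective x
      rw [← he]
      change e' ((P : Matrix (Fin m) (Fin m) R).mulVec (e.symm (e (A.mulVec v)))) =
        pb.gen • e' ((P : Matrix (Fin m) (Fin m) R).mulVec (e.symm (e v)))
      rw [← he', e.symm_apply_apply, e.symm_apply_apply, Matrix.mulVec_mulVec,
        Matrix.mulVec_mulVec, hPA]
    exact ⟨{ φ with map_smul' := pb.map_smul_of_map_gen_smul φ.toLinearMap hφ }⟩
  · rintro ⟨φ⟩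
    let p : (Fin m → R) ≃ₗ[R] (Fin m → R) := e ≪≫ₗ φ.restrictScalars R ≪≫ₗ e'.symm
    have hp : ∀ v, p (A.mulVec v) = B.mulVec (p v) := by
      intro v
      apply e'.injective
      change e' (e'.symm (φ (e (A.mulVec v)))) = e' (B.mulVec (e'.symm (φ (e v))))
      rw [he', e'.apply_symm_apply, e'.apply_symm_apply, he, map_smul]
    let P : GL (Fin m) R :=
      ⟨LinearMap.toMatrix' p.toLinearMap, LinearMap.toMatrix' p.symm.toLinearMap,
        by rw [← LinearMap.toMatrix'_comp, p.comp_symm, LinearMap.toMatrix'_id],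
        by rw [← LinearMap.toMatrix'_comp, p.symm_comp, LinearMap.toMatrix'_id]⟩
    refine ⟨P, ?_⟩
    rw [Units.mul_inv_eq_iff_eq_mul]
    apply Matrix.toLin'.injective
    ext1 i
    ext1
    simp only [Matrix.toLin'_mul, P, Matrix.toLin'_toMatrix', LinearMap.comp_apply,
      Matrix.toLin'_apply, LinearEquiv.coe_coe, hp]

section Domain

variable [IsDomain R] [IsPrincipalIdealRing R] [IsDomain S]

/-- A matrix whose characteristic polynomial vanishes at the generator describes
multiplication by the generator on some nonzero ideal. -/
theorem exists_ideal_isMulGenMatrix (pb : PowerBasis R S) {m : ℕ} (hm : pb.dim = m)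
    (A : Matrix (Fin m) (Fin m) R) (hA : Polynomial.aeval pb.gen A.charpoly = 0) :
    ∃ I : Ideal S, I ≠ ⊥ ∧ pb.IsMulGenMatrix A I := by
  subst hm
  have hdet : (Matrix.scalar (Fin pb.dim) pb.gen - A.map (algebraMap R S)).det = 0 := by
    rw [← Matrix.eval_charpoly, Matrix.charpoly_map,
      Polynomial.eval_map_algebraMap, hA]
  obtain ⟨u, hu, hu'⟩ := Matrix.exists_vecMul_eq_zero_iff.2 hdet
  rw [Matrix.vecMul_sub, sub_eq_zero] at hu'
  let ψ : (Fin pb.dim → R) →ₗ[R] S := Fintype.linearCombination R u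
  have hψ_apply (v) : ψ v = u ⬝ᵥ (algebraMap R S ∘ v) := by
    simp [ψ, Fintype.linearCombination_apply, dotProduct, Algebra.smul_def, mul_comm]
  have hψ (v) : ψ (A.mulVec v) = pb.gen * ψ v := by
    have hmap : algebraMap R S ∘ A.mulVec v =
        (A.map (algebraMap R S)).mulVec (algebraMap R S ∘ v) :=
      funext fun i => RingHom.map_mulVec _ A v i
    rw [hψ_apply, hψ_apply, hmap, Matrix.dotProduct_mulVec, ← hu']
    simp [dotProduct, Finset.mul_sum, mul_assoc, mul_left_comm]
  have hrange : ∀ s : S, ∀ x ∈ LinearMap.range ψ, s * x ∈ LinearMap.range ψ := by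
    intro s
    have hs : s ∈ Algebra.adjoin R {pb.gen} := by rw [pb.adjoin_gen_eq_top]; trivial
    induction hs using Algebra.adjoin_induction with
    | mem y hy =>
      rintro _ ⟨v, rfl⟩
      exact ⟨A.mulVec v, by rw [Set.mem_singleton_iff.1 hy, hψ]⟩
    | algebraMap r =>
      intro x hx
      rw [← Algebra.smul_def]
      exact Submodule.smul_mem _ r hx
    | add y z _ _ hy hz =>
      intro x hx
      rw [add_mul]
      exact add_mem (hy x hx) (hz x hx)
    | mul y z _ _ hy hz =>
      intro x hx
      rw [mul_assoc]
      exact hy _ (hz x hx)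
  let I : Ideal S := { (LinearMap.range ψ).toAddSubmonoid with
    smul_mem' := fun s x hx => hrange s x hx }
  have hI : I ≠ ⊥ := by
    obtain ⟨i, hi⟩ := Function.ne_iff.1 hu
    refine (Submodule.ne_bot_iff I).2 ⟨u i, ⟨Pi.single i 1, ?_⟩, hi⟩
    simp [ψ]
  let ψI : (Fin pb.dim → R) →ₗ[R] I :=
    { toFun := fun v => ⟨ψ v, v, rfl⟩
      map_add' := fun v w => Subtype.ext (map_add ψ v w)
      map_smul' := fun r v => Subtype.ext (map_smul ψ r v) }
  have hsurj : Function.Surjective ψI := by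
    rintro ⟨_, v, rfl⟩
    exact ⟨v, rfl⟩
  have hinj : Function.Injective ψI := by
    have h := OrzechProperty.injective_of_surjective_endomorphism
      ((I.selfBasis pb.basis hI).equivFun.toLinearMap ∘ₗ ψI)
      ((I.selfBasis pb.basis hI).equivFun.surjective.comp hsurj)
    rw [LinearMap.coe_comp] at h
    exact h.of_comp
  exact ⟨I, hI, LinearEquiv.ofBijective ψI ⟨hinj, hsurj⟩, fun v => Subtype.ext (hψ v)⟩

/-- On a nonzero ideal, multiplication by the generator has, in a suitable basis, a matrix
whose characteristic polynomial vanishes at the generator. -/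
theorem exists_isMulGenMatrix_of_ne_bot (pb : PowerBasis R S) {m : ℕ} (hm : pb.dim = m)
    {I : Ideal S} (hI : I ≠ ⊥) :
    ∃ A : Matrix (Fin m) (Fin m) R,
      Polynomial.aeval pb.gen A.charpoly = 0 ∧ pb.IsMulGenMatrix A I := by
  subst hm
  let b := I.selfBasis pb.basis hI
  let μ : Module.End R I := Algebra.lsmul R R I pb.gen
  refine ⟨LinearMap.toMatrix b b μ, ?_, b.equivFun.symm, fun v => ?_⟩
  · obtain ⟨x, hxI, hx⟩ := (Submodule.ne_bot_iff I).1 hI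
    have hμ : Polynomial.aeval μ (LinearMap.toMatrix b b μ).charpoly = 0 := by
      have := Module.Finite.of_basis b
      have := Module.Free.of_basis b
      rw [LinearMap.charpoly_toMatrix, LinearMap.aeval_self_charpoly]
    rw [Polynomial.aeval_algHom_apply] at hμ
    have h := congrArg Subtype.val (LinearMap.congr_fun hμ ⟨x, hxI⟩)
    exact (mul_eq_zero.1 h).resolve_right hx
  · obtain ⟨x, rfl⟩ := b.equivFun.surjective v
    rw [LinearEquiv.symm_apply_apply, LinearEquiv.symm_apply_eq]
    exact LinearMap.toMatrix_mulVec_repr b b μ x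

end Domain

/-- A monic polynomial of degree `pb.dim` vanishing at the generator is unique. -/
theorem eq_of_monic_of_aeval_gen_eq_zero [Nontrivial R] (pb : PowerBasis R S) {f g : R[X]}
    (hf : f.Monic) (hg : g.Monic) (hfdeg : f.natDegree = pb.dim) (hgdeg : g.natDegree = pb.dim)
    (hf0 : Polynomial.aeval pb.gen f = 0) (hg0 : Polynomial.aeval pb.gen g = 0) : f = g := by
  by_contra hne
  have hlt : (f - g).degree < f.degree :=
    Polynomial.degree_sub_lt_left (by rw [Polynomial.degree_eq_natDegree hf.ne_zero,
      Polynomial.degree_eq_natDegree hg.ne_zero, hfdeg, hgdeg]) hf.ne_zero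
      (by rw [hf.leadingCoeff, hg.leadingCoeff])
  have hle := pb.dim_le_degree_of_root (sub_ne_zero.2 hne) (by rw [map_sub, hf0, hg0, sub_zero])
  rw [Polynomial.degree_eq_natDegree hf.ne_zero, hfdeg] at hlt
  exact absurd hlt hle.not_gt

/-- Let `S` be a domain that has a power basis over a principal ideal domain `R`, with
generator a root of the monic polynomial `f`.  Conjugacy classes of matrices with characteristic
polynomial `f` correspond to isomorphism classes of nonzero ideals of `S`. -/
theorem nonempty_conjugacy_classes_equiv_ideal_classes [IsDomain R] [IsPrincipalIdealRing R]
    [IsDomain S] (pb : PowerBasis R S) {m : ℕ} (hm : pb.dim = m) {f : R[X]} (hf : f.Monic)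
    (hdeg : f.natDegree = m) (hf0 : Polynomial.aeval pb.gen f = 0) :
    Nonempty
      ((Quot fun A B : {A : Matrix (Fin m) (Fin m) R // A.charpoly = f} =>
          ∃ P : GL (Fin m) R,
            (P : Matrix (Fin m) (Fin m) R) * (A : Matrix (Fin m) (Fin m) R) *
                ((P⁻¹ : GL (Fin m) R) : Matrix (Fin m) (Fin m) R) =
              (B : Matrix (Fin m) (Fin m) R)) ≃
        (Quot fun I J : {I : Ideal S // I ≠ ⊥} =>
          Nonempty ((I : Ideal S) ≃ₗ[S] (J : Ideal S)))) := by
  refine nonempty_quot_equiv_of_rel (fun A I => pb.IsMulGenMatrix A.1 I.1) ?_ ?_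
    (fun A => ⟨1, by simp⟩) (fun I => ⟨LinearEquiv.refl _ _⟩)
    (fun _ _ _ _ hA hB => hA.conj_iff hB)
  · rintro ⟨A, rfl⟩
    obtain ⟨I, hI, h⟩ := pb.exists_ideal_isMulGenMatrix hm A hf0
    exact ⟨⟨I, hI⟩, h⟩
  · rintro ⟨I, hI⟩
    obtain ⟨A, hA, h⟩ := pb.exists_isMulGenMatrix_of_ne_bot hm hI
    exact ⟨⟨A, pb.eq_of_monic_of_aeval_gen_eq_zero A.charpoly_monic hf
      (by rw [A.charpoly_natDegree_eq_dim, Fintype.card_fin, hm]) (hdeg.trans hm.symm) hA hf0⟩, h⟩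

end PowerBasis

/-- **Conjugacy classes with irreducible characteristic polynomial and ideal classes.**
Let `K` be a number field whose ring of integers `𝓞 K` is a principal ideal domain and let
`f ∈ (𝓞 K)[t]` be monic of degree `m` and irreducible over `K`.  Then the conjugacy classes
(under `GL_m (𝓞 K)`) of `m × m` matrices over `𝓞 K` with characteristic polynomial `f` are
in bijection with the isomorphism classes (as `(𝓞 K)[t]/(f)`-modules) of nonzero ideals of
`(𝓞 K)[t]/(f)`. -/
theorem conjugacy_classes_equiv_ideal_classes
    (K : Type*) [Field K] [NumberField K] [IsPrincipalIdealRing (𝓞 K)]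
    (m : ℕ) (f : (𝓞 K)[X]) (hmonic : f.Monic) (hdeg : f.natDegree = m)
    (hirr : Irreducible (f.map (algebraMap (𝓞 K) K))) :
    Nonempty
      ((Quot fun A B : {A : Matrix (Fin m) (Fin m) (𝓞 K) // A.charpoly = f} =>
          ∃ P : GL (Fin m) (𝓞 K),
            (P : Matrix (Fin m) (Fin m) (𝓞 K)) * (A : Matrix (Fin m) (Fin m) (𝓞 K)) *
                ((P⁻¹ : GL (Fin m) (𝓞 K)) : Matrix (Fin m) (Fin m) (𝓞 K)) =
              (B : Matrix (Fin m) (Fin m) (𝓞 K))) ≃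
        (Quot fun I J : {I : Ideal ((𝓞 K)[X] ⧸ Ideal.span {f}) // I ≠ ⊥} =>
          Nonempty
            ((I : Ideal ((𝓞 K)[X] ⧸ Ideal.span {f})) ≃ₗ[(𝓞 K)[X] ⧸ Ideal.span {f}]
              (J : Ideal ((𝓞 K)[X] ⧸ Ideal.span {f}))))) := by
  have hprime : Prime f :=
    ((Polynomial.Monic.irreducible_iff_irreducible_map_fraction_map (K := K) hmonic).2 hirr).prime
  have : IsDomain (AdjoinRoot f) := AdjoinRoot.isDomain_of_prime hprime
  exact (AdjoinRoot.powerBasis' hmonic).nonempty_conjugacy_classes_equiv_ideal_classes hdeg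
    hmonic hdeg (AdjoinRoot.aeval_eq f |>.trans AdjoinRoot.mk_self)
end
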